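/- Suppose that for all natural numbers r ≥ 2 and all k, n ∈ ℕ, every unimodular row (a₀(t), …, a_r(t)) over B^ℤ_{r,k,n}[t] with (a₀(0), …, a_r(0)) = (1, 0, …, 0) is completable. Then for every commutative local ring R, the polynomial ring R[t] is Hermite; consequently, for every commutative Hermite ring A, the polynomial ring A[t] is Hermite. -/

import Mathlib

open Polynomial

/-- Unimodular row: the entries generate the unit ideal. -/
def IsUnimodular {A : Type} [CommRing A] {n : ℕ} (v : Fin n → A) : Prop :=
  Ideal.span (Set.range v) = ⊤

/-- A row is completable if it occurs as a row of an invertible square matrix. -/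
def IsCompletable {A : Type} [CommRing A] {n : ℕ} (v : Fin n → A) : Prop :=
  ∃ M : Matrix (Fin n) (Fin n) A, IsUnit M ∧ ∃ i, M i = v

/-- The set `S_{r,n}` of variables `x_{i,j}` (left summand) and `y_{i,j}` (right summand),
for `0 ≤ i ≤ r` and `0 ≤ j ≤ n`. -/
abbrev FinVars (r n : ℕ) : Type := (Fin (r + 1) × Fin (n + 1)) ⊕ (Fin (r + 1) × Fin (n + 1))

/-- The polynomial `p_ℓ = Σ_{i=0}^r Σ_{j=0}^ℓ x_{i,j} y_{i,ℓ-j}` in `R[S_{r,n}]`. -/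
noncomputable def pFin (R : Type) [CommRing R] (r n : ℕ) (ℓ : Fin (n + 1)) :
    MvPolynomial (FinVars r n) R :=
  ∑ i : Fin (r + 1), ∑ j : Fin (ℓ.1 + 1),
    MvPolynomial.X (Sum.inl (i, ⟨j.1, by have := j.isLt; have := ℓ.isLt; omega⟩)) *
    MvPolynomial.X (Sum.inr (i, ⟨ℓ.1 - j.1, by have := ℓ.isLt; omega⟩))

/-- The ideal of `R[S_{r,n}]` generated by the `p_ℓ` with `0 ≤ ℓ ≤ n`, `ℓ ≠ k`. -/
noncomputable def JFin (R : Type) [CommRing R] (r k n : ℕ) :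
    Ideal (MvPolynomial (FinVars r n) R) :=
  Ideal.span {q | ∃ ℓ : Fin (n + 1), (ℓ : ℕ) ≠ k ∧ q = pFin R r n ℓ}

/-- The ring `B^R_{r,k,n} = R[S_{r,n}]/(p₀, …, p̂_k, …, p_n)`. -/
def BFin (R : Type) [CommRing R] (r k n : ℕ) : Type :=
  MvPolynomial (FinVars r n) R ⧸ JFin R r k n

noncomputable instance (R : Type) [CommRing R] (r k n : ℕ) : CommRing (BFin R r k n) :=
  inferInstanceAs (CommRing (MvPolynomial (FinVars r n) R ⧸ JFin R r k n))

/-- A finitely generated module `P` over `A` is stably free if `P ⊕ Aᵐ ≅ Aⁿ` for some `m, n`. -/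
def IsStablyFree (A : Type) [CommRing A] (P : Type) [AddCommGroup P] [Module A P] : Prop :=
  ∃ m n : ℕ, Nonempty ((P × (Fin m → A)) ≃ₗ[A] (Fin n → A))

/-- A commutative ring is Hermite if all finitely generated stably free modules are free. -/
def IsHermite (A : Type) [CommRing A] : Prop :=
  ∀ (P : Type) [AddCommGroup P] [Module A P] [Module.Finite A P],
    IsStablyFree A P → Module.Free A P

open scoped TensorProduct

/-- Nakayama for ideals of `R[t]` containing a monic polynomial. -/
theorem ideal_eq_top_of_monic {R : Type} [CommRing R] [IsLocalRing R] (I : Ideal R[X])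
    (F f : R[X]) (hF : F ∈ I) (hFm : F.Monic) (hf : f ∈ I)
    (hf1 : f.map (IsLocalRing.residue R) = 1) : I = ⊤ := by
  by_contra hI
  obtain ⟨M, hM, hIM⟩ := Ideal.exists_le_maximal I hI
  have hintegral : ((Ideal.Quotient.mk M).comp (C : R →+* R[X])).IsIntegral := by
    have hX : ((Ideal.Quotient.mk M).comp (C : R →+* R[X])).IsIntegralElem
        (Ideal.Quotient.mk M X) := by
      refine ⟨F, hFm, ?_⟩
      have : eval₂ ((Ideal.Quotient.mk M).comp (C : R →+* R[X])) (Ideal.Quotient.mk M X) F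
          = Ideal.Quotient.mk M (eval₂ C X F) := (hom_eval₂ F C (Ideal.Quotient.mk M) X).symm
      rw [this, eval₂_C_X]
      exact Ideal.Quotient.eq_zero_iff_mem.2 (hIM hF)
    intro x
    obtain ⟨p, rfl⟩ := Ideal.Quotient.mk_surjective x
    induction p using Polynomial.induction_on' with
    | add p q hp hq => rw [map_add]; exact RingHom.IsIntegralElem.add _ hp hq
    | monomial n a =>
      rw [← C_mul_X_pow_eq_monomial, map_mul, map_pow]
      refine RingHom.IsIntegralElem.mul _ (RingHom.isIntegralElem_map _) ?_
      induction n with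
      | zero => simpa using RingHom.IsIntegralElem.of_mem_closure _ hX hX (by
          exact Subring.one_mem _)
      | succ n ih => rw [pow_succ]; exact RingHom.IsIntegralElem.mul _ ih hX
  have : (⊥ : Ideal (R[X] ⧸ M)).IsMaximal := by
    have := Ideal.Quotient.field M
    exact Ideal.bot_quotient_isMaximal_iff M |>.2 hM
  have hmax := Ideal.isMaximal_comap_of_isIntegral_of_isMaximal' _ hintegral (⊥ : Ideal (R[X] ⧸ M))
  have hmax' := IsLocalRing.eq_maximalIdeal hmax
  have hmem : f - 1 ∈ M := by
    rw [← Ideal.Quotient.eq_zero_iff_mem]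
    rw [(f - 1).as_sum_range_C_mul_X_pow, map_sum]
    refine Finset.sum_eq_zero fun i _ => ?_
    have h0 : (f - 1).coeff i ∈ IsLocalRing.maximalIdeal R := by
      rw [← IsLocalRing.residue_eq_zero_iff, ← coeff_map]
      simp [hf1]
    rw [← hmax'] at h0
    have h1 : Ideal.Quotient.mk M (C ((f - 1).coeff i)) = 0 := by simpa using h0
    rw [map_mul, h1, zero_mul]
  apply hM.ne_top
  rw [Ideal.eq_top_iff_one]
  have := M.sub_mem (hIM hf) hmem
  simpa using this

/-- Stably free modules of rank one are free. -/
theorem rank_one_free {A : Type} [CommRing A] (k : ℕ) (Q : Type) [AddCommGroup Q] [Module A Q]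
    (e : (Q × (Fin k → A)) ≃ₗ[A] (Fin (k + 1) → A)) : Nonempty (Q ≃ₗ[A] A) := by
  classical
  -- matrix with rows `w, e(0, ε_i)`
  let c : Fin k → Fin (k + 1) → A := fun i => e (0, Pi.single i 1)
  let D : (Fin (k + 1) → A) → A := fun w => Matrix.det (Matrix.of (Fin.cons w c : Fin (k + 1) → Fin (k + 1) → A))
  let DL : (Fin (k + 1) → A) →ₗ[A] A :=
    { toFun := D
      map_add' := fun x y => by
        have := (Matrix.detRowAlternating (R := A) (n := Fin (k+1))).map_update_add
          (Fin.cons 0 c : Fin (k + 1) → Fin (k + 1) → A) 0 x y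
        simp only [Fin.update_cons_zero] at this
        exact this
      map_smul' := fun a x => by
        have := (Matrix.detRowAlternating (R := A) (n := Fin (k+1))).map_update_smul
          (Fin.cons 0 c : Fin (k + 1) → Fin (k + 1) → A) 0 a x
        simp only [Fin.update_cons_zero] at this
        exact this }
  have hDc : ∀ i, DL (c i) = 0 := fun i => by
    refine Matrix.det_zero_of_row_eq (i := 0) (j := i.succ) (Fin.succ_ne_zero i).symm ?_
    rfl
  have he0 : ∀ d : Fin k → A, e (0, d) = ∑ i, d i • c i := fun d => by
    have : (0, d) = ∑ i, d i • ((0 : Q), (Pi.single i 1 : Fin k → A)) := by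
      ext1
      · simp [Prod.fst_sum]
      · simp only [Prod.snd_sum, Prod.smul_snd]
        exact pi_eq_sum_univ' d
    rw [this, map_sum]; simp only [map_smul, c]
  have hD0 : ∀ d : Fin k → A, DL (e (0, d)) = 0 := fun d => by
    rw [he0, map_sum]; simp [hDc]
  have hsurj : LinearMap.range DL = ⊤ := by
    by_contra hne
    obtain ⟨M, hM, hIM⟩ := Ideal.exists_le_maximal (LinearMap.range DL) hne
    let := Ideal.Quotient.field M
    let F := A ⧸ M
    let q : A →+* F := Ideal.Quotient.mk M
    let cF : Fin k → Fin (k + 1) → F := fun i j => q (c i j)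
    have hli : LinearIndependent F cF := by
      rw [Fintype.linearIndependent_iff]
      intro g hg i
      choose g' hg' using fun i => Ideal.Quotient.mk_surjective (I := M) (g i)
      have h1 : ∀ j, (∑ i, g' i • c i) j ∈ M := fun j => by
        rw [← Ideal.Quotient.eq_zero_iff_mem]
        have := congrFun hg j
        simp only [Finset.sum_apply, Pi.smul_apply, smul_eq_mul, Pi.zero_apply, cF] at this
        simp only [Finset.sum_apply, Pi.smul_apply, smul_eq_mul, map_sum, map_mul, hg']
        exact this
      have h2 : (e.symm (∑ i, g' i • c i)).2 = g' := by
        rw [← he0]; simp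
      have h3 : ∀ w : Fin (k + 1) → A, (∀ j, w j ∈ M) → ∀ i, (e.symm w).2 i ∈ M := by
        intro w hw i
        have : w = ∑ j, w j • (Pi.single j 1 : Fin (k + 1) → A) := pi_eq_sum_univ' w
        rw [this, map_sum, Prod.snd_sum, Finset.sum_apply]
        refine M.sum_mem fun j _ => ?_
        rw [map_smul, Prod.smul_snd, Pi.smul_apply, smul_eq_mul]
        exact M.mul_mem_right _ (hw j)
      have h4 := h3 _ h1 i
      rw [h2] at h4
      rw [← hg']
      exact Ideal.Quotient.eq_zero_iff_mem.2 h4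
    have hspan : ∃ w : Fin (k + 1) → F, w ∉ Submodule.span F (Set.range cF) := by
      by_contra hall
      push Not at hall
      have htop : Submodule.span F (Set.range cF) = ⊤ := by
        rw [eq_top_iff]; exact fun w _ => hall w
      have h5 := finrank_span_eq_card hli
      rw [htop, finrank_top] at h5
      simp at h5
    obtain ⟨w, hw⟩ := hspan
    have hli2 : LinearIndependent F (Fin.cons w cF : Fin (k + 1) → Fin (k + 1) → F) :=
      linearIndependent_finCons.2 ⟨hli, hw⟩
    have hunit := Matrix.linearIndependent_rows_iff_isUnit
      (A := Matrix.of (Fin.cons w cF : Fin (k + 1) → Fin (k + 1) → F)) |>.1 hli2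
    rw [Matrix.isUnit_iff_isUnit_det] at hunit
    choose w' hw' using fun i => Ideal.Quotient.mk_surjective (I := M) (w i)
    have h6 : q (DL w') = 0 := Ideal.Quotient.eq_zero_iff_mem.2 (hIM ⟨w', rfl⟩)
    apply hunit.ne_zero
    rw [← h6]
    change _ = q (Matrix.det _)
    rw [RingHom.map_det]
    congr 1
    ext i j
    refine Fin.cases ?_ (fun i => ?_) i
    · simpa using (hw' j).symm
    · simp [cF]
  obtain ⟨w, hw⟩ : ∃ w, DL w = 1 := LinearMap.range_eq_top.1 hsurj 1
  let x := (e.symm w).1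
  have hx : DL (e (x, 0)) = 1 := by
    have : (x, (0 : Fin k → A)) = e.symm w - (0, (e.symm w).2) := by ext1 <;> simp [x]
    rw [this, map_sub, map_sub, hD0]; simp [hw]
  let N : Matrix (Fin (k + 1)) (Fin (k + 1)) A := Matrix.of (Fin.cons (e (x, 0)) c : Fin (k + 1) → Fin (k + 1) → A)
  have hN : IsUnit N.det := by
    have : N.det = 1 := hx
    rw [this]; exact isUnit_one
  -- every vector is a combination of rows
  have hcomb : ∀ y : Fin (k + 1) → A, ∃ d : Fin (k + 1) → A, Matrix.vecMul d N = y := fun y =>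
    ⟨Matrix.vecMul y N⁻¹, by rw [Matrix.vecMul_vecMul, Matrix.nonsing_inv_mul _ hN, Matrix.vecMul_one]⟩
  have hrow : ∀ d : Fin (k + 1) → A, Matrix.vecMul d N = e (d 0 • x, fun i => d i.succ) := by
    intro d
    have : (d 0 • x, fun i => d i.succ) = d 0 • (x, (0 : Fin k → A)) + (0, fun i => d i.succ) := by
      ext1 <;> simp
    rw [this, map_add, map_smul, he0]
    rw [Matrix.vecMul_eq_sum, Fin.sum_univ_succ]
    rfl
  refine ⟨(LinearEquiv.ofBijective (LinearMap.toSpanSingleton A Q x) ⟨?_, ?_⟩).symm⟩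
  · rw [← LinearMap.ker_eq_bot, LinearMap.ker_eq_bot']
    intro a ha
    have ha' : a • x = 0 := ha
    have h1 : a • e (x, 0) = 0 := by
      rw [← map_smul]
      simp [ha']
    have h2 := congrArg DL h1
    rw [map_smul, hx] at h2
    simpa using h2
  · intro z
    obtain ⟨d, hd⟩ := hcomb (e (z, 0))
    rw [hrow] at hd
    have := congrArg Prod.fst (e.injective hd)
    exact ⟨d 0, this⟩

/-- A functional which kills `p` and is onto, after base change to a principal ideal domain. -/
theorem exists_functional_aux {A K : Type} [CommRing A] [CommRing K] [IsDomain K]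
    [IsPrincipalIdealRing K] [Algebra A K] (hρ : Function.Surjective (algebraMap A K))
    (P : Type) [AddCommGroup P] [Module A P] [Module.Finite A P] [Module.Projective A P]
    (p p' : P) (ψ ψ' : P →ₗ[A] A) (g : A) (hg0 : algebraMap A K g ≠ 0)
    (h1 : ψ p = g) (h2 : ψ p' = 0) (h3 : ψ' p = 0) (h4 : ψ' p' = g) :
    ∃ (φ : P →ₗ[A] A) (v : P), algebraMap A K (φ p) = 0 ∧ algebraMap A K (φ v) = 1 := by
  classical
  have : Module.Free K (K ⊗[A] P) := by
    have : Module.Projective K (K ⊗[A] P) := inferInstance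
    have : Module.Finite K (K ⊗[A] P) := inferInstance
    exact inferInstance
  let ext : (P →ₗ[A] A) → (K ⊗[A] P →ₗ[K] K) := fun θ =>
    (TensorProduct.AlgebraTensorModule.rid A K K).toLinearMap ∘ₗ θ.baseChange K
  have hext : ∀ θ w, ext θ (1 ⊗ₜ[A] w) = algebraMap A K (θ w) := fun θ w => by
    simp only [ext, LinearMap.comp_apply, LinearMap.baseChange_tmul, LinearEquiv.coe_coe,
      TensorProduct.AlgebraTensorModule.rid_tmul]
    rw [Algebra.smul_def, mul_one]
  have hli : LinearIndependent K ![(1 : K) ⊗ₜ[A] p, (1 : K) ⊗ₜ[A] p'] := by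
    rw [LinearIndependent.pair_iff]
    intro s t hst
    have e1 := congrArg (ext ψ) hst
    have e2 := congrArg (ext ψ') hst
    rw [map_add, map_smul, map_smul, hext, hext, map_zero] at e1 e2
    rw [h1, h2] at e1
    rw [h3, h4] at e2
    simp only [map_zero, smul_eq_mul, mul_zero, add_zero, zero_add] at e1 e2
    exact ⟨(mul_eq_zero.1 e1).resolve_right hg0, (mul_eq_zero.1 e2).resolve_right hg0⟩
  have hrank := hli.fintype_card_le_finrank
  rw [Fintype.card_fin] at hrank
  let b := Module.finBasis K (K ⊗[A] P)
  let i0 : Fin (Module.finrank K (K ⊗[A] P)) := ⟨0, by omega⟩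
  let i1 : Fin (Module.finrank K (K ⊗[A] P)) := ⟨1, by omega⟩
  have hi : i0 ≠ i1 := by simp [i0, i1]
  let q0 := b.coord i0 ((1 : K) ⊗ₜ[A] p)
  let q1 := b.coord i1 ((1 : K) ⊗ₜ[A] p)
  -- coprime `u0, u1` with `u0 q1 = u1 q0`
  obtain ⟨u0, u1, x, y, hu, hxy⟩ : ∃ u0 u1 x y : K, u0 * q1 = u1 * q0 ∧ x * u0 + y * u1 = 1 := by
    by_cases hq : q0 = 0 ∧ q1 = 0
    · exact ⟨1, 0, 1, 0, by simp [hq.1, hq.2], by simp⟩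
    · obtain ⟨d, hd⟩ := IsPrincipalIdealRing.principal (Ideal.span {q0, q1})
      have hq0 : q0 ∈ Ideal.span {q0, q1} := Ideal.subset_span (by simp)
      have hq1 : q1 ∈ Ideal.span {q0, q1} := Ideal.subset_span (by simp)
      have hdm : d ∈ Ideal.span {q0, q1} := by
        rw [hd]; exact Submodule.mem_span_singleton_self d
      rw [hd] at hq0 hq1
      obtain ⟨u0, hu0⟩ := Submodule.mem_span_singleton.1 hq0
      obtain ⟨u1, hu1⟩ := Submodule.mem_span_singleton.1 hq1
      obtain ⟨x, y, hxy⟩ := Ideal.mem_span_pair.1 hdm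
      rw [smul_eq_mul] at hu0 hu1
      have hd0 : d ≠ 0 := by
        rintro rfl
        exact hq ⟨by rw [← hu0, mul_zero], by rw [← hu1, mul_zero]⟩
      refine ⟨u0, u1, x, y, ?_, ?_⟩
      · rw [← hu0, ← hu1]; ring
      · apply mul_left_cancel₀ hd0
        linear_combination x * hu0 + y * hu1 + hxy
  let φK : K ⊗[A] P →ₗ[K] K := u0 • b.coord i1 - u1 • b.coord i0
  let vK : K ⊗[A] P := x • b i1 - y • b i0
  have hφp : φK ((1 : K) ⊗ₜ[A] p) = 0 := by
    simp only [φK, LinearMap.sub_apply, LinearMap.smul_apply, smul_eq_mul]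
    exact sub_eq_zero.2 hu
  have hφv : φK vK = 1 := by
    simp only [φK, vK, LinearMap.sub_apply, LinearMap.smul_apply, smul_eq_mul, map_sub, map_smul,
      Module.Basis.coord_apply, Module.Basis.repr_self, Finsupp.single_apply, hi, hi.symm]
    simp only [if_true, if_false]
    linear_combination hxy
  let φ' : P →ₗ[A] K := (φK.restrictScalars A) ∘ₗ (TensorProduct.mk A K P 1)
  obtain ⟨φ, hφ⟩ := Module.projective_lifting_property (Algebra.linearMap A K) φ' hρ
  have hφ1 : ∀ w, algebraMap A K (φ w) = φK (1 ⊗ₜ[A] w) := fun w => LinearMap.congr_fun hφ w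
  obtain ⟨v, hv⟩ : ∃ v : P, (1 : K) ⊗ₜ[A] v = vK := TensorProduct.mk_surjective A P K hρ vK
  refine ⟨φ, v, ?_, ?_⟩
  · exact (hφ1 p).trans hφp
  · exact (hφ1 v).trans (by rw [hv, hφv])

/-- Over the residue field: a functional which kills `p` and is onto, modulo the maximal ideal. -/
theorem exists_functional {R : Type} [CommRing R] [IsLocalRing R] (P : Type) [AddCommGroup P]
    [Module R[X] P] [Module.Finite R[X] P] [Module.Projective R[X] P]
    (p p' : P) (ψ ψ' : P →ₗ[R[X]] R[X]) (g : R[X]) (hg : g.Monic)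
    (h1 : ψ p = g) (h2 : ψ p' = 0) (h3 : ψ' p = 0) (h4 : ψ' p' = g) :
    ∃ (φ : P →ₗ[R[X]] R[X]) (v : P), (φ p).map (IsLocalRing.residue R) = 0 ∧
      (φ v).map (IsLocalRing.residue R) = 1 := by
  let _ : Algebra R[X] (IsLocalRing.ResidueField R)[X] :=
    (mapRingHom (IsLocalRing.residue R)).toAlgebra
  exact exists_functional_aux (K := (IsLocalRing.ResidueField R)[X])
    (Polynomial.map_surjective _ IsLocalRing.residue_surjective) P p p' ψ ψ' g
    (hg.map _).ne_zero h1 h2 h3 h4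

/-- Affine Horrocks theorem for stably free modules. -/
theorem horrocks {R : Type} [CommRing R] [IsLocalRing R] (m : ℕ) :
    ∀ (P : Type) [AddCommGroup P] [Module R[X] P] [Module.Finite R[X] P]
    [Module.Projective R[X] P] (ι : (Fin (m + 1) → R[X]) →ₗ[R[X]] P)
    (ψ : P →ₗ[R[X]] (Fin (m + 1) → R[X])) (g : R[X]) (_ : g.Monic)
    (_ : ∀ c, ψ (ι c) = g • c) (_ : ∀ w, ι (ψ w) = g • w) (k : ℕ)
    (_ : (P × (Fin k → R[X])) ≃ₗ[R[X]] (Fin (k + m + 1) → R[X])),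
    Nonempty (P ≃ₗ[R[X]] (Fin (m + 1) → R[X])) := by
  classical
  induction m with
  | zero =>
    intro P _ _ _ _ ι ψ g hg h1 h2 k e
    obtain ⟨f⟩ := rank_one_free k P e
    exact ⟨f ≪≫ₗ (LinearEquiv.funUnique (Fin 1) R[X] R[X]).symm⟩
  | succ m ih =>
    intro P _ _ _ _ ι ψ g hg h1 h2 k e
    let p : Fin (m + 2) → P := fun i => ι (Pi.single i 1)
    have hψp : ∀ i j, ψ (p i) j = if i = j then g else 0 := fun i j => by
      simp only [p, h1, Pi.smul_apply, Pi.single_apply, smul_eq_mul, mul_ite, mul_one, mul_zero]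
      simp only [eq_comm]
    obtain ⟨φ, v, hφ0, hφv⟩ := exists_functional P (p 0) (p 1) (LinearMap.proj 0 ∘ₗ ψ)
      (LinearMap.proj 1 ∘ₗ ψ) g hg (by simp [hψp]) (by simp [hψp]) (by simp [hψp])
      (by simp [hψp])
    let N := (ψ v 0).natDegree + 1
    let p' : P := (X ^ N : R[X]) • p 0 + v
    let F : R[X] := ψ p' 0
    have hF : F = X ^ N * g + ψ v 0 := by simp [F, p', hψp]
    have hFm : F.Monic := by
      rw [hF]
      refine Monic.add_of_left ((monic_X_pow N).mul hg) ?_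
      rw [hg.degree_mul, degree_X_pow]
      refine lt_of_le_of_lt degree_le_natDegree ?_
      have : ((ψ v 0).natDegree : WithBot ℕ) < (N : WithBot ℕ) := by
        exact_mod_cast Nat.lt_succ_self _
      refine lt_of_lt_of_le this ?_
      rw [degree_eq_natDegree hg.ne_zero]
      exact_mod_cast Nat.le_add_right _ _
    have hφp' : (φ p').map (IsLocalRing.residue R) = 1 := by
      simp [p', hφ0, hφv]
    have htop := ideal_eq_top_of_monic (Ideal.span {F, φ p'}) F (φ p')
      (Ideal.subset_span (by simp)) hFm (Ideal.subset_span (by simp)) hφp'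
    obtain ⟨α, β, hαβ⟩ := Ideal.mem_span_pair.1 ((Ideal.eq_top_iff_one _).1 htop)
    let θ : P →ₗ[R[X]] R[X] := α • (LinearMap.proj 0 ∘ₗ ψ) + β • φ
    have hθ : θ p' = 1 := by simpa [θ, F] using hαβ
    let Q := LinearMap.ker θ
    let π : P →ₗ[R[X]] Q := LinearMap.codRestrict Q
      (LinearMap.id - (LinearMap.toSpanSingleton R[X] P p') ∘ₗ θ) (fun w => by
        simp [Q, hθ])
    have hπ : ∀ w, (π w : P) = w - θ w • p' := fun w => rfl
    have hπQ : ∀ w : Q, π w = w := fun w => by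
      ext1
      rw [hπ, LinearMap.mem_ker.1 w.2, zero_smul, sub_zero]
    have hπp' : π p' = 0 := by ext1; simp [hπ, hθ]
    have : Module.Finite R[X] Q := Module.Finite.of_surjective π (fun w => ⟨w, hπQ w⟩)
    have : Module.Projective R[X] Q := Module.Projective.of_split Q.subtype π
      (by ext1 w; exact hπQ w)
    let E : P ≃ₗ[R[X]] (R[X] × Q) :=
      { toFun := fun w => (θ w, π w)
        map_add' := fun x y => by simp
        map_smul' := fun a x => by simp
        invFun := fun z => z.1 • p' + z.2
        left_inv := fun w => by simp [hπ]
        right_inv := fun z => by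
          have hz := LinearMap.mem_ker.1 z.2.2
          ext1
          · simp [hθ, hz]
          · simp [hπp', hπQ] }
    let incl : (Fin (m + 1) → R[X]) →ₗ[R[X]] (Fin (m + 2) → R[X]) :=
      { toFun := fun c => Fin.cons 0 c
        map_add' := fun x y => by
          ext1 i; refine Fin.cases ?_ (fun i => ?_) i <;> simp
        map_smul' := fun a x => by
          ext1 i; refine Fin.cases ?_ (fun i => ?_) i <;> simp }
    let ι' : (Fin (m + 1) → R[X]) →ₗ[R[X]] Q := π ∘ₗ ι ∘ₗ incl
    let ψP : P →ₗ[R[X]] (Fin (m + 1) → R[X]) := LinearMap.pi fun i =>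
      F • (LinearMap.proj i.succ ∘ₗ ψ) - ψ p' i.succ • (LinearMap.proj 0 ∘ₗ ψ)
    have hψP : ∀ w i, ψP w i = F * ψ w i.succ - ψ p' i.succ * ψ w 0 := fun w i => by
      simp [ψP]
    have hψPp' : ψP p' = 0 := by
      ext1 i; rw [hψP]; simp only [F, Pi.zero_apply]; ring
    let ψ' : Q →ₗ[R[X]] (Fin (m + 1) → R[X]) := ψP ∘ₗ Q.subtype
    have hψπ : ∀ w, ψ' (π w) = ψP w := fun w => by
      simp [ψ', hπ, hψPp']
    have k1 : ∀ c, ψ' (ι' c) = (F * g) • c := fun c => by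
      change ψ' (π (ι (incl c))) = _
      rw [hψπ]
      ext1 i
      rw [hψP, h1]
      simp [incl, mul_assoc]
    have k2 : ∀ w, ι' (ψ' w) = (F * g) • w := fun w => by
      have hin : incl (ψ' w) = F • ψ (w : P) - ψ (w : P) 0 • ψ p' := by
        ext1 i
        refine Fin.cases ?_ (fun i => ?_) i
        · simp only [incl, LinearMap.coe_mk, AddHom.coe_mk, Fin.cons_zero, Pi.sub_apply,
            Pi.smul_apply, smul_eq_mul, F]
          ring
        · have : ψ' w i = ψP (w : P) i := rfl
          simp only [incl, LinearMap.coe_mk, AddHom.coe_mk, Fin.cons_succ, Pi.sub_apply,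
            Pi.smul_apply, smul_eq_mul, this, hψP]
          ring
      change π (ι (incl (ψ' w))) = _
      rw [hin, map_sub, map_smul, map_smul, h2, h2, map_sub, map_smul, map_smul, map_smul,
        map_smul, hπp', hπQ, smul_zero, smul_zero, sub_zero, smul_smul]
    have eQ : (Q × (Fin (k + 1) → R[X])) ≃ₗ[R[X]] (Fin (k + 1 + m + 1) → R[X]) :=
      (LinearEquiv.prodCongr (LinearEquiv.refl _ Q) (Fin.consLinearEquiv R[X] (fun _ => R[X])).symm)
      ≪≫ₗ (LinearEquiv.prodAssoc R[X] Q R[X] (Fin k → R[X])).symm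
      ≪≫ₗ (LinearEquiv.prodCongr ((LinearEquiv.prodComm R[X] Q R[X]) ≪≫ₗ E.symm)
        (LinearEquiv.refl _ _)) ≪≫ₗ e ≪≫ₗ
        LinearEquiv.funCongrLeft R[X] R[X] (finCongr (by omega))
    obtain ⟨f⟩ := ih Q ι' ψ' (F * g) (hFm.mul hg) k1 k2 (k + 1) eQ
    exact ⟨E ≪≫ₗ LinearEquiv.prodCongr (LinearEquiv.refl _ _) f ≪≫ₗ
      Fin.consLinearEquiv R[X] (fun _ => R[X])⟩

theorem isUnimodular_iff {A : Type} [CommRing A] {n : ℕ} (a : Fin n → A) :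
    IsUnimodular a ↔ ∃ b : Fin n → A, a ⬝ᵥ b = 1 := by
  unfold IsUnimodular
  rw [Ideal.eq_top_iff_one]
  constructor
  · intro h
    obtain ⟨c, hc⟩ := (Ideal.mem_span_range_iff_exists_fun).1 h
    exact ⟨c, by rw [dotProduct_comm]; exact hc⟩
  · rintro ⟨b, hb⟩
    refine (Ideal.mem_span_range_iff_exists_fun).2 ⟨b, ?_⟩
    rw [dotProduct_comm] at hb; exact hb

/-- The linear functional given by a row. -/
def rowMap {A : Type} [CommRing A] {n : ℕ} (a : Fin n → A) : (Fin n → A) →ₗ[A] A where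
  toFun v := a ⬝ᵥ v
  map_add' := dotProduct_add a
  map_smul' c v := dotProduct_smul c a v

theorem rowMap_apply {A : Type} [CommRing A] {n : ℕ} (a v : Fin n → A) :
    rowMap a v = a ⬝ᵥ v := rfl

theorem isCompletable_vecMul {A : Type} [CommRing A] {n : ℕ} (a : Fin n → A)
    (h : IsCompletable a) (G : Matrix (Fin n) (Fin n) A) (hG : IsUnit G) :
    IsCompletable (Matrix.vecMul a G) := by
  obtain ⟨M, hM, i, rfl⟩ := h
  exact ⟨M * G, hM.mul hG, i, Matrix.mul_apply_eq_vecMul _ _ _⟩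

theorem isCompletable_map {A B : Type} [CommRing A] [CommRing B] {n : ℕ} (f : A →+* B)
    (a : Fin n → A) (h : IsCompletable a) : IsCompletable (fun i => f (a i)) := by
  obtain ⟨M, hM, i, rfl⟩ := h
  exact ⟨f.mapMatrix M, hM.map f.mapMatrix, i, rfl⟩

theorem isCompletable_single {A : Type} [CommRing A] {n : ℕ} (i : Fin n) :
    IsCompletable (Pi.single i (1 : A)) :=
  ⟨1, isUnit_one, i, by ext j; rw [Matrix.one_apply, Pi.single_apply]; simp [eq_comm]⟩

theorem isUnimodular_of_completable {A : Type} [CommRing A] {n : ℕ} (a : Fin n → A)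
    (h : IsCompletable a) : IsUnimodular a := by
  obtain ⟨M, hM, i, rfl⟩ := h
  obtain ⟨U, rfl⟩ := hM
  rw [isUnimodular_iff]
  refine ⟨fun j => (↑U⁻¹ : Matrix (Fin n) (Fin n) A) j i, ?_⟩
  have : ((U : Matrix (Fin n) (Fin n) A) * (↑U⁻¹ : Matrix (Fin n) (Fin n) A)) i i = 1 := by
    rw [Units.mul_inv]; simp
  exact this

theorem ker_free_of_completable {A : Type} [CommRing A] {r : ℕ} (a : Fin (r + 1) → A)
    (h : IsCompletable a) : Nonempty (LinearMap.ker (rowMap a) ≃ₗ[A] (Fin r → A)) := by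
  obtain ⟨M, hM, i, rfl⟩ := h
  obtain ⟨U, rfl⟩ := hM
  set M := (U : Matrix (Fin (r+1)) (Fin (r+1)) A)
  set N := (↑U⁻¹ : Matrix (Fin (r+1)) (Fin (r+1)) A)
  have hMN : M * N = 1 := U.mul_inv
  have hNM : N * M = 1 := U.inv_mul
  let f : LinearMap.ker (rowMap (M i)) →ₗ[A] (Fin r → A) :=
    { toFun := fun v j => M.mulVec v.1 (i.succAbove j)
      map_add' := fun v w => by ext j; simp [Matrix.mulVec_add]
      map_smul' := fun c v => by ext j; simp [Matrix.mulVec_smul] }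
  have hv : ∀ v : LinearMap.ker (rowMap (M i)), M.mulVec v.1 = i.insertNth 0 (f v) := by
    intro v
    rw [Fin.eq_insertNth_iff]
    exact ⟨v.2, rfl⟩
  refine ⟨LinearEquiv.ofBijective f ⟨?_, ?_⟩⟩
  · intro v w hvw
    apply Subtype.ext
    have : N.mulVec (M.mulVec v.1) = N.mulVec (M.mulVec w.1) := by rw [hv, hv, hvw]
    simpa [Matrix.mulVec_mulVec, hNM] using this
  · intro w
    have key : M.mulVec (N.mulVec (i.insertNth (α := fun _ => A) 0 w)) = i.insertNth (α := fun _ => A) 0 w := by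
      rw [Matrix.mulVec_mulVec, hMN, Matrix.one_mulVec]
    refine ⟨⟨N.mulVec (i.insertNth (α := fun _ => A) 0 w), ?_⟩, ?_⟩
    · have := congrFun key i
      rw [Fin.insertNth_apply_same] at this
      exact this
    · ext j
      have := congrFun key (i.succAbove j)
      rw [Fin.insertNth_apply_succAbove] at this
      exact this

/-- The splitting of `A^n` given by `a ⬝ b = 1`. -/
theorem exists_split {A : Type} [CommRing A] {n : ℕ} (a b : Fin n → A) (hab : a ⬝ᵥ b = 1) :
    ∃ E : (Fin n → A) ≃ₗ[A] (LinearMap.ker (rowMap a) × A),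
      ∀ v, (E v).2 = a ⬝ᵥ v := by
  have hk : ∀ v : Fin n → A, v - (a ⬝ᵥ v) • b ∈ LinearMap.ker (rowMap a) := by
    intro v
    rw [LinearMap.mem_ker, rowMap_apply, dotProduct_sub, dotProduct_smul, hab]
    simp
  let f : (Fin n → A) →ₗ[A] (LinearMap.ker (rowMap a) × A) :=
    LinearMap.prod
      (LinearMap.codRestrict _ (LinearMap.id - (rowMap a).smulRight b) hk) (rowMap a)
  let g : (LinearMap.ker (rowMap a) × A) →ₗ[A] (Fin n → A) :=
    LinearMap.coprod (Submodule.subtype _) (LinearMap.toSpanSingleton A _ b)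
  have hg : ∀ p, g p = p.1.1 + p.2 • b := fun p => rfl
  have hf2 : ∀ v, (f v).2 = a ⬝ᵥ v := fun v => rfl
  have hf1 : ∀ v, (f v).1.1 = v - (a ⬝ᵥ v) • b := fun v => rfl
  refine ⟨LinearEquiv.ofLinearMap f g ?_ ?_, fun v => rfl⟩
  · refine LinearMap.ext fun p => ?_
    have hp : a ⬝ᵥ p.1.1 = 0 := p.1.2
    refine Prod.ext (Subtype.ext ?_) ?_
    · simp [hf1, hg, hp, hab]
    · simp [hf2, hg, hp, hab]
  · refine LinearMap.ext fun v => ?_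
    simp [hf1, hf2, hg]

theorem completable_of_ker_free {A : Type} [CommRing A] {r : ℕ} (a : Fin (r + 1) → A)
    (ha : IsUnimodular a) (e : LinearMap.ker (rowMap a) ≃ₗ[A] (Fin r → A)) :
    IsCompletable a := by
  obtain ⟨b, hab⟩ := (isUnimodular_iff a).1 ha
  obtain ⟨E, hE⟩ := exists_split a b hab
  let F := (E.trans (LinearEquiv.prodComm A _ _)).trans
    ((LinearEquiv.prodCongr (LinearEquiv.refl A A) e).trans
      (Fin.consLinearEquiv A (fun _ : Fin (r+1) => A)))
  refine ⟨LinearMap.toMatrix' F.toLinearMap, ?_, 0, ?_⟩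
  · have h1 : LinearMap.toMatrix' F.toLinearMap * LinearMap.toMatrix' F.symm.toLinearMap = 1 := by
      rw [← LinearMap.toMatrix'_comp]; simp
    have h2 : LinearMap.toMatrix' F.symm.toLinearMap * LinearMap.toMatrix' F.toLinearMap = 1 := by
      rw [← LinearMap.toMatrix'_comp]; simp
    exact ⟨⟨_, _, h1, h2⟩, rfl⟩
  · ext j
    rw [LinearMap.toMatrix'_apply]
    have : F (Pi.single j 1) 0 = (E (Pi.single j 1)).2 := by
      simp [F, Fin.consLinearEquiv]
    simp only [LinearEquiv.coe_coe]
    rw [this, hE]; simp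

theorem horrocks_row {R : Type} [CommRing R] [IsLocalRing R] (m : ℕ)
    (a b l : Fin (m + 2) → R[X]) (hab : a ⬝ᵥ b = 1) (e : ℕ) (he : (l ⬝ᵥ b).degree < e)
    (hc : IsCompletable (fun i => X ^ e * a i + l i)) : IsCompletable a := by
  have hxm : (X ^ e + l ⬝ᵥ b).Monic := monic_X_pow_add he
  set x := X ^ e + l ⬝ᵥ b with hx
  set a' : Fin (m + 2) → R[X] := fun i => X ^ e * a i + l i with ha'
  have ha'v : ∀ v, a' ⬝ᵥ v = X ^ e * (a ⬝ᵥ v) + l ⬝ᵥ v := by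
    intro v
    have : a' = (X ^ e : R[X]) • a + l := rfl
    rw [this, add_dotProduct, smul_dotProduct, smul_eq_mul]
  obtain ⟨ε⟩ := ker_free_of_completable a' hc
  obtain ⟨E, hE⟩ := exists_split a b hab
  have : Module.Finite R[X] (LinearMap.ker (rowMap a)) :=
    Module.Finite.of_surjective ((LinearMap.fst _ _ _).comp E.toLinearMap)
      (fun p => ⟨E.symm (p, 0), by simp⟩)
  have : Module.Projective R[X] (LinearMap.ker (rowMap a)) :=
    Module.Projective.of_split (E.symm.toLinearMap.comp (LinearMap.inl _ _ _))
      ((LinearMap.fst _ _ _).comp E.toLinearMap) (by ext v; simp)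
  let H : (Fin (m + 2) → R[X]) →ₗ[R[X]] (Fin (m + 2) → R[X]) :=
    (X ^ e : R[X]) • LinearMap.id + (rowMap l).smulRight b
  let u : (Fin (m + 2) → R[X]) →ₗ[R[X]] (Fin (m + 2) → R[X]) :=
    x • LinearMap.id - (rowMap l).smulRight b
  have hH : ∀ v, H v = (X ^ e : R[X]) • v + (l ⬝ᵥ v) • b := fun v => rfl
  have hu : ∀ v, u v = x • v - (l ⬝ᵥ v) • b := fun v => rfl
  have hHk : ∀ v, a' ⬝ᵥ v = 0 → a ⬝ᵥ H v = 0 := by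
    intro v hv
    rw [hH, dotProduct_add, dotProduct_smul, dotProduct_smul, hab, smul_eq_mul, smul_eq_mul,
      mul_one, ← ha'v, hv]
  have huk : ∀ v, a ⬝ᵥ v = 0 → a' ⬝ᵥ u v = 0 := by
    intro v hv
    simp only [ha'v, hu, dotProduct_sub, dotProduct_smul, hab, hv, smul_eq_mul, hx]
    ring
  have hHu : ∀ v, H (u v) = (X ^ e * x) • v := by
    intro v
    simp only [hH, hu, dotProduct_sub, dotProduct_smul, smul_eq_mul, hx]
    module
  have huH : ∀ v, u (H v) = (X ^ e * x) • v := by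
    intro v
    simp only [hH, hu, dotProduct_add, dotProduct_smul, smul_eq_mul, hx]
    module
  let H' : LinearMap.ker (rowMap a') →ₗ[R[X]] LinearMap.ker (rowMap a) :=
    H.restrict (fun v hv => hHk v hv)
  let u' : LinearMap.ker (rowMap a) →ₗ[R[X]] LinearMap.ker (rowMap a') :=
    u.restrict (fun v hv => huk v hv)
  have hHu' : ∀ v, H' (u' v) = (X ^ e * x) • v := fun v => Subtype.ext (hHu v)
  have huH' : ∀ v, u' (H' v) = (X ^ e * x) • v := fun v => Subtype.ext (huH v)
  obtain ⟨f⟩ := horrocks m (LinearMap.ker (rowMap a)) (H'.comp ε.symm.toLinearMap)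
    (ε.toLinearMap.comp u') (X ^ e * x) ((monic_X_pow e).mul hxm)
    (fun c => by simp [huH']) (fun w => by simp [hHu']) 1
    (((LinearEquiv.prodCongr (LinearEquiv.refl _ _) (LinearEquiv.funUnique (Fin 1) R[X] R[X])).trans
      E.symm).trans (LinearEquiv.funCongrLeft R[X] R[X] (finCongr (by omega))))
  exact completable_of_ker_free a ((isUnimodular_iff a).2 ⟨b, hab⟩) f

theorem perturb {R : Type} [CommRing R] [IsLocalRing R] (r N : ℕ) (p q : Fin (r + 2) → R[X])
    (hp : ∀ i, (p i).natDegree ≤ N) (hq : ∀ i, (q i).natDegree ≤ N)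
    (hW : (p ⬝ᵥ q).natDegree ≤ N) (hWu : IsUnit ((p ⬝ᵥ q).coeff N)) :
    ∃ l : Fin (r + 2) → R[X], (∀ i, (l i).degree < ((N + 2 : ℕ) : WithBot ℕ)) ∧
      IsUnimodular (fun i => X ^ (N + 2) * p i + l i) := by
  classical
  let φ := IsLocalRing.residue R
  have hφ : Function.Surjective φ := IsLocalRing.residue_surjective
  obtain ⟨i, hi⟩ : ∃ i, (p i).map φ ≠ 0 := by
    by_contra! hcon
    have h1 : (p ⬝ᵥ q).map φ = 0 := by
      rw [dotProduct, Polynomial.map_sum]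
      refine Finset.sum_eq_zero fun i _ => ?_
      rw [Polynomial.map_mul, hcon, zero_mul]
    have h2 : φ ((p ⬝ᵥ q).coeff N) = 0 := by rw [← coeff_map, h1, coeff_zero]
    exact (hWu.map φ).ne_zero h2
  obtain ⟨i', hi'⟩ := exists_ne i
  set D := X * (p i).map φ with hD
  have hD0 : D ≠ 0 := mul_ne_zero X_ne_zero hi
  set lb := (1 - X ^ (N + 2) * (p i').map φ) % D with hlb
  have hlbdeg : lb.degree < ((N + 2 : ℕ) : WithBot ℕ) := by
    refine lt_of_lt_of_le (Polynomial.degree_mod_lt _ hD0) ?_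
    rw [degree_le_iff_coeff_zero]
    intro m hm
    apply coeff_eq_zero_of_natDegree_lt
    refine lt_of_le_of_lt natDegree_mul_le ?_
    have := natDegree_map_le (f := φ) (p := p i)
    have := hp i
    have := natDegree_X_le (R := IsLocalRing.ResidueField R)
    have : N + 2 < m := by exact_mod_cast hm
    omega
  obtain ⟨l', hl', hl'deg⟩ := Polynomial.exists_degree_eq_of_mem_lifts
    (show lb ∈ Polynomial.lifts φ from (Polynomial.mem_lifts _).2 (Polynomial.map_surjective φ hφ lb))
  refine ⟨Pi.single i' l', ?_, ?_⟩
  · intro j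
    by_cases hj : j = i'
    · subst hj; rw [Pi.single_eq_same, hl'deg]; exact hlbdeg
    · rw [Pi.single_eq_of_ne hj, degree_zero]; exact WithBot.bot_lt_coe _
  set a' : Fin (r + 2) → R[X] := fun j => X ^ (N + 2) * p j + (Pi.single i' l' : Fin (r+2) → R[X]) j with ha'
  have ha'i : a' i = X ^ (N + 2) * p i := by
    simp [ha', Pi.single_eq_of_ne hi'.symm]
  have ha'i' : a' i' = X ^ (N + 2) * p i' + l' := by simp [ha']
  have hmem : ∀ j, a' j ∈ Ideal.span (Set.range a') := fun j => Ideal.subset_span ⟨j, rfl⟩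
  obtain ⟨w, hw⟩ := hWu
  have hdot : a' ⬝ᵥ q = X ^ (N + 2) * (p ⬝ᵥ q) + l' * q i' := by
    have : a' = (X ^ (N + 2) : R[X]) • p + Pi.single i' l' := rfl
    rw [this, add_dotProduct, smul_dotProduct, smul_eq_mul, single_dotProduct]
  have hl'nat : l'.natDegree ≤ N + 1 := by
    rw [hl'deg.symm] at hlbdeg
    have := natDegree_le_iff_degree_le (p := l') (n := N+1)
    rw [this]
    exact Order.le_of_lt_succ (by exact_mod_cast hlbdeg)
  have hlq : (l' * q i').natDegree ≤ N + 1 + N := by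
    refine natDegree_mul_le.trans ?_
    have := hq i'; omega
  have hmap' : (a' i').map φ = 1 - D * ((1 - X ^ (N + 2) * (p i').map φ) / D) := by
    have h1 := EuclideanDomain.div_add_mod (1 - X ^ (N + 2) * (p i').map φ) D
    rw [← hlb] at h1
    rw [ha'i', Polynomial.map_add, Polynomial.map_mul, Polynomial.map_pow, map_X, hl']
    linear_combination h1
  have hmap : (a' i).map φ = X ^ (N + 1) * D := by
    rw [ha'i, Polynomial.map_mul, Polynomial.map_pow, map_X, hD]; ring
  set Q := (1 - X ^ (N + 2) * (p i').map φ) / D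
  have hcop1 : IsCoprime ((a' i').map φ) D := ⟨1, Q, by rw [hmap']; ring⟩
  have hcop2 : IsCoprime ((a' i').map φ) X :=
    ⟨1, (p i).map φ * Q, by rw [hmap', hD]; ring⟩
  have hcop : IsCoprime ((a' i').map φ) ((a' i).map φ) := by
    rw [hmap]
    exact (hcop2.pow_right).mul_right hcop1
  obtain ⟨u, v, huv⟩ := hcop
  obtain ⟨u, rfl⟩ := Polynomial.map_surjective φ hφ u
  obtain ⟨v, rfl⟩ := Polynomial.map_surjective φ hφ v
  refine ideal_eq_top_of_monic _ (C (↑w⁻¹ : R) * (a' ⬝ᵥ q)) (u * a' i' + v * a' i) ?_ ?_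
    (Ideal.add_mem _ (Ideal.mul_mem_left _ _ (hmem i')) (Ideal.mul_mem_left _ _ (hmem i))) ?_
  · refine Ideal.mul_mem_left _ _ (Ideal.sum_mem _ fun j _ => Ideal.mul_mem_right _ _ (hmem j))
  · refine monic_of_natDegree_le_of_coeff_eq_one (N + 2 + N) ?_ ?_
    · refine (natDegree_C_mul_le _ _).trans ?_
      rw [hdot]
      refine natDegree_add_le_of_degree_le ?_ (by omega)
      refine natDegree_mul_le.trans ?_
      have := natDegree_X_pow_le (R := R) (N+2)
      omega
    · rw [hdot, coeff_C_mul, coeff_add, coeff_eq_zero_of_natDegree_lt (p := l' * q i') (by omega),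
        add_zero, add_comm (N+2) N, coeff_X_pow_mul, ← hw, Units.inv_mul]
  · rw [Polynomial.map_add, Polynomial.map_mul, Polynomial.map_mul]
    exact huv
set_option linter.unusedSimpArgs false

theorem scale_lift {K K' ι : Type} [CommRing K] [CommRing K'] [Algebra K K'] (S : Submonoid K)
    [IsLocalization S K'] [Finite ι] (p : ι → K'[X]) (k0 : ι → K)
    (hp : ∀ i, (p i).coeff 0 = algebraMap K K' (k0 i)) :
    ∃ f : S, ∃ q : ι → K[X], ∀ i, (q i).coeff 0 = k0 i ∧
      (q i).map (algebraMap K K') = (p i).comp (C (algebraMap K K' f) * X) := by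
  classical
  have := Fintype.ofFinite ι
  obtain ⟨f, hf⟩ := IsLocalization.exist_integer_multiples_of_finset S
    (Finset.univ.biUnion (fun i => (p i).coeffs))
  have h1 : ∀ i, ∃ q : K[X], q.coeff 0 = k0 i ∧
      q.map (algebraMap K K') = (p i).comp (C (algebraMap K K' f) * X) := by
    intro i
    have h2 : (p i).comp (C (algebraMap K K' f) * X) ∈ Polynomial.lifts (algebraMap K K') := by
      rw [Polynomial.lifts_iff_coeff_lifts]
      intro n
      rw [comp_C_mul_X_coeff]
      rcases n with _ | n
      · exact ⟨k0 i, by rw [hp]; simp⟩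
      · by_cases h0 : (p i).coeff (n + 1) = 0
        · exact ⟨0, by rw [h0]; simp⟩
        · obtain ⟨c, hc⟩ := hf ((p i).coeff (n + 1))
            (Finset.mem_biUnion.2 ⟨i, Finset.mem_univ _, Polynomial.coeff_mem_coeffs h0⟩)
          refine ⟨c * f ^ n, ?_⟩
          rw [map_mul, hc, map_pow, Algebra.smul_def]; ring
    obtain ⟨q, hq⟩ := (Polynomial.mem_lifts _).1 h2
    refine ⟨q - C (q.coeff 0) + C (k0 i), by simp, ?_⟩
    have h3 : algebraMap K K' (q.coeff 0) = algebraMap K K' (k0 i) := by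
      rw [← coeff_map, hq, comp_C_mul_X_coeff, hp]; simp
    rw [Polynomial.map_add, Polynomial.map_sub, map_C, map_C, h3, hq]; ring
  choose q hq using h1
  exact ⟨f, q, hq⟩

theorem scale_kill {K K' ι : Type} [CommRing K] [CommRing K'] [Algebra K K'] (S : Submonoid K)
    [IsLocalization S K'] [Finite ι] (q : ι → K[X]) (hq0 : ∀ i, (q i).coeff 0 = 0)
    (hq : ∀ i, (q i).map (algebraMap K K') = 0) :
    ∃ f : S, ∀ i, (q i).comp (C (f : K) * X) = 0 := by
  classical
  have := Fintype.ofFinite ι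
  have h1 : ∀ i n, ∃ s : S, (s : K) * (q i).coeff n = 0 := by
    intro i n
    rw [← IsLocalization.map_eq_zero_iff S K', ← coeff_map, hq, coeff_zero]
  choose s hs using h1
  refine ⟨∏ i, ∏ n ∈ (q i).support, s i n, fun i => ?_⟩
  ext n
  rw [comp_C_mul_X_coeff, coeff_zero]
  rcases n with _ | n
  · rw [hq0]; simp
  · by_cases h0 : (q i).coeff (n + 1) = 0
    · rw [h0, zero_mul]
    · have hd : s i (n + 1) ∣ ∏ i, ∏ n ∈ (q i).support, s i n :=
        (Finset.dvd_prod_of_mem _ (mem_support_iff.2 h0)).trans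
          (Finset.dvd_prod_of_mem (fun i => ∏ n ∈ (q i).support, s i n) (Finset.mem_univ i))
      obtain ⟨t, ht⟩ := hd
      rw [ht, pow_succ]
      push_cast
      linear_combination ((s i (n+1) : K) * t) ^ n * t * hs i (n + 1)

theorem completable_to_single {A : Type} [CommRing A] {r : ℕ} (v : Fin (r + 1) → A)
    (h : IsCompletable v) : ∃ G : (Matrix (Fin (r + 1)) (Fin (r + 1)) A)ˣ,
      Matrix.vecMul v (G : Matrix (Fin (r + 1)) (Fin (r + 1)) A) = Pi.single 0 1 := by
  obtain ⟨M, hM, i, rfl⟩ := h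
  have h2 := (Matrix.isUnit_submatrix_equiv (A := M) (Equiv.swap 0 i) (Equiv.refl _)).2 hM
  obtain ⟨U, hU⟩ := h2
  refine ⟨U⁻¹, ?_⟩
  have h3 : M i = Matrix.vecMul (Pi.single 0 1) (U : Matrix (Fin (r + 1)) (Fin (r + 1)) A) := by
    rw [hU, Matrix.single_one_vecMul]; ext j; simp [Matrix.row]
  rw [h3, Matrix.vecMul_vecMul, Units.mul_inv, Matrix.vecMul_one]

theorem completable_of_unit {A : Type} [CommRing A] {n : ℕ} (v : Fin n → A) (i : Fin n)
    (h : IsUnit (v i)) : IsCompletable v := by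
  refine ⟨Matrix.updateRow 1 i v, ?_, i, Matrix.updateRow_self⟩
  rw [Matrix.isUnit_iff_isUnit_det, ← Matrix.cramer_transpose_apply]
  simpa using h

theorem completable_of_local {A : Type} [CommRing A] [IsLocalRing A] {n : ℕ} (v : Fin n → A)
    (h : IsUnimodular v) : IsCompletable v := by
  by_contra hcon
  have h1 : ∀ i, v i ∈ IsLocalRing.maximalIdeal A := fun i hi => hcon (completable_of_unit v i hi)
  have h2 : Ideal.span (Set.range v) ≤ IsLocalRing.maximalIdeal A := by
    rw [Ideal.span_le]; rintro _ ⟨i, rfl⟩; exact h1 i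
  rw [h] at h2
  exact (IsLocalRing.maximalIdeal.isMaximal A).ne_top (top_le_iff.1 h2)

theorem isUnimodular_map {A B : Type} [CommRing A] [CommRing B] {n : ℕ} (f : A →+* B)
    (a : Fin n → A) (h : IsUnimodular a) : IsUnimodular (fun i => f (a i)) := by
  rw [isUnimodular_iff] at *
  obtain ⟨b, hb⟩ := h
  refine ⟨fun i => f (b i), ?_⟩
  rw [← map_one f, ← hb, dotProduct, dotProduct, map_sum]
  simp

theorem isUnimodular_vecMul {A : Type} [CommRing A] {n : ℕ} (a : Fin n → A)
    (h : IsUnimodular a) (G : (Matrix (Fin n) (Fin n) A)ˣ) :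
    IsUnimodular (Matrix.vecMul a (G : Matrix (Fin n) (Fin n) A)) := by
  rw [isUnimodular_iff] at *
  obtain ⟨b, hb⟩ := h
  refine ⟨Matrix.mulVec (↑G⁻¹ : Matrix (Fin n) (Fin n) A) b, ?_⟩
  rw [Matrix.dotProduct_mulVec, Matrix.vecMul_vecMul, Units.mul_inv, Matrix.vecMul_one, hb]

theorem descent_single {B K : Type} [CommRing B] [CommRing K] [Algebra B K] (S : Submonoid B)
    [IsLocalization S K] (r : ℕ)
    (hB : ∀ a : Fin (r + 1) → B[X], IsUnimodular a →
        (∀ i, (a i).eval 0 = if i = 0 then 1 else 0) → IsCompletable a)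
    (a : Fin (r + 1) → K[X]) (ha : IsUnimodular a)
    (ha0 : ∀ i, (a i).coeff 0 = if i = 0 then 1 else 0) : IsCompletable a := by
  obtain ⟨b', hb'⟩ := (isUnimodular_iff a).1 ha
  -- normalise `b`
  obtain ⟨b, hb, hb0⟩ : ∃ b : Fin (r + 1) → K[X], a ⬝ᵥ b = 1 ∧
      ∀ i, (b i).coeff 0 = if i = 0 then 1 else 0 := by
    let c : Fin r → K := fun j => (b' j.succ).coeff 0
    refine ⟨Fin.cons (b' 0 + ∑ j : Fin r, C (c j) * a j.succ) (fun j => b' j.succ - C (c j) * a 0),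
      ?_, ?_⟩
    · rw [dotProduct, Fin.sum_univ_succ] at hb' ⊢
      simp only [Fin.cons_zero, Fin.cons_succ, mul_sub, Finset.sum_sub_distrib, mul_add,
        Finset.mul_sum]
      rw [← hb']
      have : ∑ i : Fin r, a 0 * (C (c i) * a i.succ) = ∑ i : Fin r, a i.succ * (C (c i) * a 0) :=
        Finset.sum_congr rfl fun i _ => by ring
      rw [this]; ring
    · have h1 : (b' 0).coeff 0 = 1 := by
        have := congrArg (fun p => coeff p 0) hb'
        simp only [dotProduct, finsetSum_coeff, mul_coeff_zero, ha0, coeff_one_zero] at this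
        simpa using this
      intro i
      refine Fin.cases ?_ (fun j => ?_) i
      · simp [finsetSum_coeff, mul_coeff_zero, ha0, h1]
      · simp [mul_coeff_zero, ha0, c]
  obtain ⟨f, q, hq⟩ := scale_lift S (Sum.elim a b)
    (Sum.elim (fun i => if i = 0 then (1 : B) else 0) (fun i => if i = 0 then (1 : B) else 0))
    (by rintro (i | i) <;> simp [ha0, hb0])
  let α : Fin (r + 1) → B[X] := fun i => q (Sum.inl i)
  let β : Fin (r + 1) → B[X] := fun i => q (Sum.inr i)
  have hα : ∀ i, (α i).coeff 0 = if i = 0 then 1 else 0 := fun i => (hq (Sum.inl i)).1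
  have hβ : ∀ i, (β i).coeff 0 = if i = 0 then 1 else 0 := fun i => (hq (Sum.inr i)).1
  have hα' : ∀ i, (α i).map (algebraMap B K) = (a i).comp (C (algebraMap B K f) * X) :=
    fun i => (hq (Sum.inl i)).2
  have hβ' : ∀ i, (β i).map (algebraMap B K) = (b i).comp (C (algebraMap B K f) * X) :=
    fun i => (hq (Sum.inr i)).2
  obtain ⟨g, hg⟩ := scale_kill (K' := K) (ι := Unit) S (fun _ => α ⬝ᵥ β - 1)
    (by
      intro _
      simp [dotProduct, finsetSum_coeff, mul_coeff_zero, hα, hβ])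
    (by
      intro _
      have h1 := congrArg (fun p => p.comp (C (algebraMap B K f) * X)) hb
      simp only [dotProduct, Polynomial.sum_comp, mul_comp, one_comp] at h1
      simp only [dotProduct, Polynomial.map_sub, Polynomial.map_sum, Polynomial.map_mul, hα', hβ',
        h1, Polynomial.map_one, sub_self])
  have hg := hg ()
  let α' : Fin (r + 1) → B[X] := fun i => (α i).comp (C (g : B) * X)
  have hcomp : IsCompletable α' := by
    refine hB α' ?_ ?_
    · rw [isUnimodular_iff]
      refine ⟨fun i => (β i).comp (C (g : B) * X), ?_⟩
      simp only [dotProduct, sub_comp, Polynomial.sum_comp, mul_comp, one_comp] at hg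
      exact sub_eq_zero.1 hg
    · intro i
      rw [← coeff_zero_eq_eval_zero, comp_C_mul_X_coeff, hα]; simp
  have h2 := isCompletable_map (Polynomial.mapRingHom (algebraMap B K)) α' hcomp
  obtain ⟨u, hu⟩ : IsUnit (algebraMap B K (f * g : S)) := IsLocalization.map_units K (f * g)
  have h3 := isCompletable_map (Polynomial.compRingHom (C (↑u⁻¹ : K) * X)) _ h2
  convert h3 using 1
  ext1 i
  simp only [coe_mapRingHom, coe_compRingHom, α']
  rw [Polynomial.map_comp, hα', comp_assoc, comp_assoc]
  simp only [Polynomial.map_mul, map_C, map_X, mul_comp, C_comp, X_comp]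
  have h4 : C (algebraMap B K f) * (C (algebraMap B K g) * (C (↑u⁻¹ : K) * X)) = X := by
    rw [← mul_assoc, ← mul_assoc, ← C_mul, ← C_mul, ← map_mul, ← Submonoid.coe_mul, ← hu, Units.mul_inv]
    simp
  rw [h4, comp_X]

theorem descent {B K : Type} [CommRing B] [CommRing K] [Algebra B K] (S : Submonoid B)
    [IsLocalization S K] [IsLocalRing K] (r : ℕ)
    (hB : ∀ a : Fin (r + 1) → B[X], IsUnimodular a →
        (∀ i, (a i).eval 0 = if i = 0 then 1 else 0) → IsCompletable a)
    (a : Fin (r + 1) → K[X]) (ha : IsUnimodular a) : IsCompletable a := by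
  have h0 := isUnimodular_map (Polynomial.evalRingHom (0 : K)) a ha
  obtain ⟨G, hG⟩ := completable_to_single _ (completable_of_local _ h0)
  let G' := Units.map ((C : K →+* K[X]).mapMatrix (m := Fin (r + 1))).toMonoidHom G
  have h1 := isUnimodular_vecMul a ha G'
  have h2 := descent_single S r hB _ h1 (by
    intro i
    have := congrFun hG i
    rw [Pi.single_apply] at this
    rw [← this]
    simp [Matrix.vecMul, dotProduct, G', coeff_zero_eq_eval_zero, eval_finsetSum])
  have h3 := isCompletable_vecMul _ h2 (↑G'⁻¹) (Units.isUnit _)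
  rwa [Matrix.vecMul_vecMul, Units.mul_inv, Matrix.vecMul_one] at h3

theorem universal_pair (r k N : ℕ) :
    ∃ AX AY : Fin (r + 1) → (BFin ℤ r k N)[X],
      (∀ i, (AX i).natDegree ≤ N) ∧ (∀ i, (AY i).natDegree ≤ N) ∧
      (∀ l, l ≤ N → l ≠ k → (AX ⬝ᵥ AY).coeff l = 0) ∧
      ∀ (R : Type) [CommRing R] (p q : Fin (r + 1) → R[X]),
        (∀ i, (p i).natDegree ≤ N) → (∀ i, (q i).natDegree ≤ N) →
        (∀ l, l ≤ N → l ≠ k → (p ⬝ᵥ q).coeff l = 0) →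
        ∃ φ : BFin ℤ r k N →+* R, (∀ i, (AX i).map φ = p i) ∧ (∀ i, (AY i).map φ = q i) := by
  classical
  let π : MvPolynomial (FinVars r N) ℤ →+* BFin ℤ r k N := Ideal.Quotient.mk (JFin ℤ r k N)
  let AX0 : Fin (r + 1) → (MvPolynomial (FinVars r N) ℤ)[X] := fun i =>
    ∑ j : Fin (N + 1), monomial (j : ℕ) (MvPolynomial.X (Sum.inl (i, j)))
  let AY0 : Fin (r + 1) → (MvPolynomial (FinVars r N) ℤ)[X] := fun i =>
    ∑ j : Fin (N + 1), monomial (j : ℕ) (MvPolynomial.X (Sum.inr (i, j)))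
  have hX : ∀ i (j : ℕ) (hj : j < N + 1), (AX0 i).coeff j = MvPolynomial.X (Sum.inl (i, ⟨j, hj⟩)) := by
    intro i j hj
    simp only [AX0, finsetSum_coeff, coeff_monomial]
    rw [Finset.sum_eq_single ⟨j, hj⟩] <;> simp [Fin.ext_iff]
  have hY : ∀ i (j : ℕ) (hj : j < N + 1), (AY0 i).coeff j = MvPolynomial.X (Sum.inr (i, ⟨j, hj⟩)) := by
    intro i j hj
    simp only [AY0, finsetSum_coeff, coeff_monomial]
    rw [Finset.sum_eq_single ⟨j, hj⟩] <;> simp [Fin.ext_iff]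
  have hXd : ∀ i, (AX0 i).natDegree ≤ N := fun i =>
    natDegree_sum_le_of_forall_le _ _ fun j _ =>
      (natDegree_monomial_le _).trans (Nat.lt_succ_iff.1 j.2)
  have hYd : ∀ i, (AY0 i).natDegree ≤ N := fun i =>
    natDegree_sum_le_of_forall_le _ _ fun j _ =>
      (natDegree_monomial_le _).trans (Nat.lt_succ_iff.1 j.2)
  have hpF : ∀ l : Fin (N + 1), (AX0 ⬝ᵥ AY0).coeff l = pFin ℤ r N l := by
    intro l
    simp only [dotProduct, finsetSum_coeff, coeff_mul, pFin]
    refine Finset.sum_congr rfl fun i _ => ?_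
    rw [Finset.Nat.sum_antidiagonal_eq_sum_range_succ (fun x y => (AX0 i).coeff x * (AY0 i).coeff y),
      Finset.sum_range]
    refine Finset.sum_congr rfl fun j _ => ?_
    have := j.2; have := l.2
    rw [hX i j (by omega), hY i _ (by omega)]
  have hdot : ∀ (R : Type) [CommRing R] (f : MvPolynomial (FinVars r N) ℤ →+* R),
      (fun i => (AX0 i).map f) ⬝ᵥ (fun i => (AY0 i).map f) = (AX0 ⬝ᵥ AY0).map f := by
    intro R _ f
    simp [dotProduct, Polynomial.map_sum]
  refine ⟨fun i => (AX0 i).map π, fun i => (AY0 i).map π,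
    fun i => natDegree_map_le.trans (hXd i), fun i => natDegree_map_le.trans (hYd i), ?_, ?_⟩
  · intro l hl hlk
    rw [hdot, coeff_map, hpF ⟨l, Nat.lt_succ_iff.2 hl⟩]
    exact Ideal.Quotient.eq_zero_iff_mem.2 (Ideal.subset_span ⟨_, hlk, rfl⟩)
  · intro R _ p q hp hq hpq
    let ev : MvPolynomial (FinVars r N) ℤ →+* R := MvPolynomial.eval₂Hom (Int.castRingHom R)
      (Sum.elim (fun ij => (p ij.1).coeff ij.2) (fun ij => (q ij.1).coeff ij.2))
    have hevX : ∀ i, (AX0 i).map ev = p i := by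
      intro i; ext j
      rw [coeff_map]
      by_cases hj : j < N + 1
      · rw [hX i j hj]; simp [ev]
      · rw [coeff_eq_zero_of_natDegree_lt (lt_of_le_of_lt (hXd i) (by omega)),
          coeff_eq_zero_of_natDegree_lt (lt_of_le_of_lt (hp i) (by omega)), map_zero]
    have hevY : ∀ i, (AY0 i).map ev = q i := by
      intro i; ext j
      rw [coeff_map]
      by_cases hj : j < N + 1
      · rw [hY i j hj]; simp [ev]
      · rw [coeff_eq_zero_of_natDegree_lt (lt_of_le_of_lt (hYd i) (by omega)),
          coeff_eq_zero_of_natDegree_lt (lt_of_le_of_lt (hq i) (by omega)), map_zero]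
    have hker : ∀ x ∈ JFin ℤ r k N, ev x = 0 := by
      intro x hx
      have : JFin ℤ r k N ≤ RingHom.ker ev := by
        rw [JFin, Ideal.span_le]
        rintro _ ⟨l, hlk, rfl⟩
        rw [SetLike.mem_coe, RingHom.mem_ker, ← hpF, ← coeff_map, ← hdot]
        simp only [hevX, hevY]
        exact hpq l (Nat.lt_succ_iff.1 l.2) hlk
      exact this hx
    let φ : BFin ℤ r k N →+* R := Ideal.Quotient.lift (JFin ℤ r k N) ev hker
    have hφ : φ.comp π = ev := Ideal.Quotient.lift_comp_mk _ _ _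
    refine ⟨φ, fun i => ?_, fun i => ?_⟩
    · rw [Polynomial.map_map, hφ, hevX]
    · rw [Polynomial.map_map, hφ, hevY]

theorem reflect_dot {R : Type} [CommRing R] {m : ℕ} (p q : Fin m → R[X]) (F G : ℕ)
    (hp : ∀ i, (p i).natDegree ≤ F) (hq : ∀ i, (q i).natDegree ≤ G) :
    (fun i => reflect F (p i)) ⬝ᵥ (fun i => reflect G (q i)) = reflect (F + G) (p ⬝ᵥ q) := by
  ext j
  simp only [dotProduct, ← reflect_mul _ _ (hp _) (hq _), finsetSum_coeff, coeff_reflect]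

theorem local_rows_long
    (h : ∀ r : ℕ, 2 ≤ r → ∀ k n : ℕ,
      ∀ a : Fin (r + 1) → Polynomial (BFin ℤ r k n), IsUnimodular a →
        (∀ i, (a i).eval 0 = if i = 0 then 1 else 0) → IsCompletable a)
    (R : Type) [CommRing R] [IsLocalRing R] (s : ℕ) (hs : 1 ≤ s) (a : Fin (s + 2) → R[X])
    (ha : IsUnimodular a) : IsCompletable a := by
  obtain ⟨b, hab⟩ := (isUnimodular_iff a).1 ha
  obtain ⟨n, hna, hnb⟩ : ∃ n, (∀ i, (a i).natDegree ≤ n) ∧ (∀ i, (b i).natDegree ≤ n) := by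
    refine ⟨Finset.univ.sup (fun i => (a i).natDegree) + Finset.univ.sup (fun i => (b i).natDegree),
      fun i => ?_, fun i => ?_⟩
    · exact le_add_right (Finset.le_sup (f := fun i => (a i).natDegree) (Finset.mem_univ i))
    · exact le_add_left (Finset.le_sup (f := fun i => (b i).natDegree) (Finset.mem_univ i))
  set N := n + n with hN
  let p : Fin (s + 2) → R[X] := fun i => reflect n (a i)
  let q : Fin (s + 2) → R[X] := fun i => reflect n (b i)
  have hp : ∀ i, (p i).natDegree ≤ n := fun i =>
    natDegree_reflect_le.trans (max_le le_rfl (hna i))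
  have hq : ∀ i, (q i).natDegree ≤ n := fun i =>
    natDegree_reflect_le.trans (max_le le_rfl (hnb i))
  have hpq : p ⬝ᵥ q = X ^ N := by
    rw [reflect_dot a b n n hna hnb, hab, reflect_one]
  obtain ⟨AX, AY, hAX, hAY, hAXY, huniv⟩ := universal_pair (s + 1) N N
  obtain ⟨φ, hφX, hφY⟩ := huniv R p q (fun i => (hp i).trans (by omega))
    (fun i => (hq i).trans (by omega)) (fun l _ hl => by rw [hpq, coeff_X_pow, if_neg hl])
  set pN := (AX ⬝ᵥ AY).coeff N with hpN
  have hdot : ∀ (K : Type) [CommRing K] (f : BFin ℤ (s + 1) N N →+* K),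
      (fun i => (AX i).map f) ⬝ᵥ (fun i => (AY i).map f) = (AX ⬝ᵥ AY).map f := by
    intro K _ f
    simp [dotProduct, Polynomial.map_sum]
  have hφN : φ pN = 1 := by
    rw [hpN, ← coeff_map, ← hdot]
    simp only [hφX, hφY]
    rw [hpq, coeff_X_pow, if_pos rfl]
  let P : Ideal (BFin ℤ (s + 1) N N) := (IsLocalRing.maximalIdeal R).comap φ
  have hP : P.IsPrime := Ideal.comap_isPrime _ _
  let K := Localization.AtPrime P
  let alg := algebraMap (BFin ℤ (s + 1) N N) K
  have hunit : ∀ y : P.primeCompl, IsUnit (φ y) := by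
    intro y
    by_contra hy
    exact y.2 ((IsLocalRing.mem_maximalIdeal _).2 hy)
  let φ' : K →+* R := IsLocalization.lift (M := P.primeCompl) hunit
  have hφ' : φ'.comp alg = φ := IsLocalization.lift_comp hunit
  have hpNu : IsUnit (alg pN) := by
    refine IsLocalization.map_units K (⟨pN, ?_⟩ : P.primeCompl)
    intro hmem
    have : φ pN ∈ IsLocalRing.maximalIdeal R := hmem
    rw [hφN] at this
    exact (IsLocalRing.maximalIdeal.isMaximal R).ne_top ((Ideal.eq_top_iff_one _).2 this)
  have hAXm : ∀ i, ((AX i).map alg).natDegree ≤ N := fun i => natDegree_map_le.trans (hAX i)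
  have hAYm : ∀ i, ((AY i).map alg).natDegree ≤ N := fun i => natDegree_map_le.trans (hAY i)
  have hdeg2 : (AX ⬝ᵥ AY).natDegree ≤ N + N :=
    natDegree_sum_le_of_forall_le _ _ fun i _ =>
      natDegree_mul_le.trans (add_le_add (hAX i) (hAY i))
  let PX : Fin (s + 2) → K[X] := fun i => reflect N ((AX i).map alg)
  let PY : Fin (s + 2) → K[X] := fun i => reflect N ((AY i).map alg)
  have hW : PX ⬝ᵥ PY = reflect (N + N) ((AX ⬝ᵥ AY).map alg) := by
    rw [← hdot]
    exact reflect_dot _ _ N N hAXm hAYm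
  obtain ⟨l, hl, hlu⟩ := perturb s N PX PY
    (fun i => natDegree_reflect_le.trans (max_le le_rfl (hAXm i)))
    (fun i => natDegree_reflect_le.trans (max_le le_rfl (hAYm i)))
    (by
      rw [natDegree_le_iff_coeff_eq_zero]
      intro m hm
      rw [hW, coeff_reflect, coeff_map]
      by_cases hm2 : m ≤ N + N
      · rw [revAt_le hm2, hAXY _ (by omega) (by omega), map_zero]
      · rw [revAt_eq_self_of_lt (by omega), coeff_eq_zero_of_natDegree_lt (by omega), map_zero])
    (by
      rw [hW, coeff_reflect, coeff_map, revAt_le (by omega), Nat.add_sub_cancel]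
      exact hpNu)
  have hcomp := descent P.primeCompl (s + 1) (h (s + 1) (by omega) N N) _ hlu
  have hcomp2 := isCompletable_map (Polynomial.mapRingHom φ') _ hcomp
  have hPX : ∀ i, (PX i).map φ' = a i * X ^ n := by
    intro i
    rw [← reflect_map, Polynomial.map_map, hφ', hφX, ← reflect_one n, hN]
    have := reflect_mul (p i) 1 (hp i) (natDegree_one.le.trans (Nat.zero_le n))
    rw [mul_one] at this
    rw [this, reflect_reflect]
  refine horrocks_row s a b (fun i => (l i).map φ') hab (N + 2 + n) ?_ ?_
  · rw [dotProduct]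
    refine (Polynomial.degree_sum_le _ _).trans_lt ?_
    rw [Finset.sup_lt_iff (WithBot.bot_lt_coe _)]
    intro i _
    refine (degree_mul_le _ _).trans_lt ?_
    have h1 : ((l i).map φ').degree < ((N + 2 : ℕ) : WithBot ℕ) := degree_map_le.trans_lt (hl i)
    have h2 : (b i).degree ≤ (n : WithBot ℕ) := natDegree_le_iff_degree_le.1 (hnb i)
    refine lt_of_le_of_lt (add_le_add le_rfl h2) ?_
    push_cast
    exact WithBot.add_lt_add_right (WithBot.coe_ne_bot) (by exact_mod_cast h1)
  · convert hcomp2 using 1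
    ext1 i
    rw [coe_mapRingHom, Polynomial.map_add, Polynomial.map_mul, Polynomial.map_pow, map_X, hPX]
    ring

theorem local_rows
    (h : ∀ r : ℕ, 2 ≤ r → ∀ k n : ℕ,
      ∀ a : Fin (r + 1) → Polynomial (BFin ℤ r k n), IsUnimodular a →
        (∀ i, (a i).eval 0 = if i = 0 then 1 else 0) → IsCompletable a)
    (R : Type) [CommRing R] [IsLocalRing R] (r : ℕ) (a : Fin (r + 1) → R[X])
    (ha : IsUnimodular a) : IsCompletable a := by
  rcases r with _ | s
  · obtain ⟨b, hab⟩ := (isUnimodular_iff a).1 ha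
    refine completable_of_unit a 0 (IsUnit.of_mul_eq_one (b 0) ?_)
    simpa [dotProduct] using hab
  · rcases Nat.eq_zero_or_pos s with rfl | hs
    · obtain ⟨b, hab⟩ := (isUnimodular_iff a).1 ha
      refine ⟨!![a 0, a 1; - b 1, b 0], ?_, 0, ?_⟩
      · rw [Matrix.isUnit_iff_isUnit_det, Matrix.det_fin_two_of]
        have hab : ∑ i : Fin 2, a i * b i = 1 := hab
        rw [Fin.sum_univ_two] at hab
        rw [show a 0 * b 0 - a 1 * - b 1 = 1 by linear_combination hab]
        exact isUnit_one
      · ext j; fin_cases j <;> rfl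
    · exact local_rows_long h R s hs a ha

theorem free_of_rows {A : Type} [CommRing A]
    (hrow : ∀ r : ℕ, ∀ a : Fin (r + 1) → A, IsUnimodular a → IsCompletable a)
    (Q : Type) [AddCommGroup Q] [Module A Q] (r : ℕ)
    (e : (Q × A) ≃ₗ[A] (Fin (r + 1) → A)) : Nonempty (Q ≃ₗ[A] (Fin r → A)) := by
  let f : (Fin (r + 1) → A) →ₗ[A] A := (LinearMap.snd A Q A).comp e.symm.toLinearMap
  let a : Fin (r + 1) → A := fun j => f (Pi.single j 1)
  have haf : rowMap a = f := by
    refine LinearMap.pi_ext' fun j => LinearMap.ext_ring ?_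
    simp [rowMap_apply, a]
  have hun : IsUnimodular a := by
    rw [isUnimodular_iff]
    refine ⟨e (0, 1), ?_⟩
    rw [← rowMap_apply, haf]
    simp [f]
  obtain ⟨g⟩ := ker_free_of_completable a (hrow r a hun)
  let i : Q →ₗ[A] LinearMap.ker (rowMap a) :=
    LinearMap.codRestrict _ (e.toLinearMap.comp (LinearMap.inl A Q A)) (fun x => by
      rw [haf]; simp [f])
  have hi : ∀ x, (i x).1 = e (x, 0) := fun x => rfl
  have hbij : Function.Bijective i := by
    constructor
    · intro x y hxy
      have h1 := congrArg Subtype.val hxy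
      rw [hi, hi] at h1
      exact (Prod.ext_iff.1 (e.injective h1)).1
    · rintro ⟨v, hv⟩
      rw [haf] at hv
      refine ⟨(e.symm v).1, Subtype.ext ?_⟩
      rw [hi]
      have h2 : (e.symm v).2 = 0 := hv
      rw [← h2]
      simp
  exact ⟨(LinearEquiv.ofBijective i hbij).trans g⟩

theorem isHermite_of_rows {A : Type} [CommRing A]
    (hrow : ∀ r : ℕ, ∀ a : Fin (r + 1) → A, IsUnimodular a → IsCompletable a) : IsHermite A := by
  intro P _ _ _ hP
  obtain ⟨m, n, ⟨e⟩⟩ := hP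
  induction m generalizing n with
  | zero =>
    exact Module.Free.of_equiv
      (((LinearEquiv.prodUnique (R := A) (M := P) (M₂ := Fin 0 → A)).symm.trans e).symm)
  | succ m ih =>
    let e1 : ((P × (Fin m → A)) × A) ≃ₗ[A] (Fin n → A) :=
      (LinearEquiv.prodAssoc A P (Fin m → A) A).trans
        ((LinearEquiv.prodCongr (LinearEquiv.refl A P)
          ((LinearEquiv.prodComm A _ _).trans
            (Fin.consLinearEquiv A (fun _ : Fin (m + 1) => A)))).trans e)
    rcases n with _ | r
    · have hs : Subsingleton ((P × (Fin m → A)) × A) := e1.toEquiv.subsingleton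
      have hs2 : Subsingleton (P × (Fin m → A)) :=
        ⟨fun x y => (Prod.ext_iff.1 (hs.elim (x, 0) (y, 0))).1⟩
      exact ih 0 (0 : _ ≃ₗ[A] _)
    · obtain ⟨g⟩ := free_of_rows hrow _ r e1
      exact ih r g

theorem rows_of_isHermite {A : Type} [CommRing A] (hA : IsHermite A) (r : ℕ)
    (a : Fin (r + 1) → A) (ha : IsUnimodular a) : IsCompletable a := by
  rcases subsingleton_or_nontrivial A with hs | hs
  · exact completable_of_unit a 0 (isUnit_of_subsingleton _)
  · obtain ⟨b, hab⟩ := (isUnimodular_iff a).1 ha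
    obtain ⟨E, hE⟩ := exists_split a b hab
    have : Module.Finite A (LinearMap.ker (rowMap a)) :=
      Module.Finite.of_surjective ((LinearMap.fst _ _ _).comp E.toLinearMap)
        (fun p => ⟨E.symm (p, 0), by simp⟩)
    have hfree : Module.Free A (LinearMap.ker (rowMap a)) := hA _ ⟨1, r + 1,
      ⟨(LinearEquiv.prodCongr (LinearEquiv.refl _ _)
        (LinearEquiv.funUnique (Fin 1) A A)).trans E.symm⟩⟩
    have h1 := E.finrank_eq
    rw [Module.finrank_prod] at h1
    simp only [Module.finrank_fin_fun, Module.finrank_self] at h1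
    exact completable_of_ker_free a ha (LinearEquiv.ofFinrankEq _ _ (by
      rw [Module.finrank_fin_fun]; omega))

/-- Substitution `p(x) ↦ p(x + c y)`, `A[x] → A[x][y]`. -/
noncomputable def shiftHom {A : Type} [CommRing A] (c : A) : A[X] →+* A[X][X] :=
  eval₂RingHom ((C : A[X] →+* A[X][X]).comp (C : A →+* A[X])) (C X + C (C c) * X)

theorem shiftHom_C {A : Type} [CommRing A] (c u : A) : shiftHom c (C u) = C (C u) := by
  simp [shiftHom]

theorem shiftHom_X {A : Type} [CommRing A] (c : A) : shiftHom c X = C X + C (C c) * X := by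
  simp [shiftHom]

theorem shiftHom_coeff_zero {A : Type} [CommRing A] (c : A) (p : A[X]) :
    (shiftHom c p).coeff 0 = p := by
  have h : (Polynomial.evalRingHom (0 : A[X])).comp (shiftHom c) = RingHom.id _ := by
    refine Polynomial.ringHom_ext (fun u => ?_) ?_
    · simp [shiftHom_C]
    · simp [shiftHom_X]
  rw [coeff_zero_eq_eval_zero]
  exact congrArg (fun f => f p) h

theorem vecMul_map {A B : Type} [CommRing A] [CommRing B] {n : ℕ} (f : A →+* B)
    (v : Fin n → A) (M : Matrix (Fin n) (Fin n) A) :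
    (fun j => f (Matrix.vecMul v M j)) = Matrix.vecMul (fun j => f (v j)) (f.mapMatrix M) := by
  ext j
  simp [Matrix.vecMul, dotProduct]

/-- The Quillen ideal of a row. -/
noncomputable def quillenIdeal {A : Type} [CommRing A] {n : ℕ} (a : Fin n → A[X]) : Ideal A where
  carrier := {c | ∃ G : Matrix (Fin n) (Fin n) A[X][X], IsUnit G ∧
    Matrix.vecMul (fun i => C (a i)) G = fun i => shiftHom c (a i)}
  zero_mem' := by
    refine ⟨1, isUnit_one, ?_⟩
    rw [Matrix.vecMul_one]
    have h : shiftHom (0 : A) = C := by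
      refine Polynomial.ringHom_ext (fun u => ?_) ?_
      · simp [shiftHom_C]
      · simp [shiftHom_X]
    rw [h]
  add_mem' := by
    rintro c d ⟨G, hG, hGc⟩ ⟨H, hH, hHd⟩
    let σ : A[X][X] →+* A[X][X] := eval₂RingHom (shiftHom c) X
    have h1 : ∀ p, σ (C p) = shiftHom c p := fun p => by simp [σ]
    have h2 : σ.comp (shiftHom d) = shiftHom (c + d) := by
      refine Polynomial.ringHom_ext (fun u => ?_) ?_
      · simp [shiftHom_C, h1]
      · simp only [RingHom.comp_apply, shiftHom_X, map_add, map_mul, h1, shiftHom_C]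
        simp [σ]; ring
    refine ⟨G * σ.mapMatrix H, hG.mul (hH.map σ.mapMatrix), ?_⟩
    rw [← Matrix.vecMul_vecMul, hGc]
    have h3 := vecMul_map σ (fun i => C (a i)) H
    simp only [h1] at h3
    rw [← h3, hHd, ← h2]; rfl
  smul_mem' := by
    rintro u c ⟨G, hG, hGc⟩
    let τ : A[X][X] →+* A[X][X] := eval₂RingHom C (C (C u) * X)
    have h1 : ∀ p, τ (C p) = C p := fun p => by simp [τ]
    have h2 : τ.comp (shiftHom c) = shiftHom (u • c) := by
      refine Polynomial.ringHom_ext (fun v => ?_) ?_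
      · simp [shiftHom_C, h1]
      · simp only [RingHom.comp_apply, shiftHom_X, map_add, map_mul, h1, smul_eq_mul]
        simp [τ]; ring
    refine ⟨τ.mapMatrix G, hG.map τ.mapMatrix, ?_⟩
    have h3 := vecMul_map τ (fun i => C (a i)) G
    simp only [h1] at h3
    rw [← h3, hGc, ← h2]; rfl

theorem quillen_local {A L : Type} [CommRing A] [CommRing L] [Algebra A L] (S : Submonoid A)
    [IsLocalization S L] {n : ℕ} (a : Fin n → A[X])
    (ha : IsCompletable (fun i => (a i).map (algebraMap A L))) :
    ∃ f ∈ S, f ∈ quillenIdeal a := by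
  let _ : Algebra A[X] L[X] := Polynomial.algebra A L
  have halg : ∀ p : A[X], algebraMap A[X] L[X] p = p.map (algebraMap A L) := fun p => by
    rw [Polynomial.algebraMap_def]; rfl
  have hloc : IsLocalization (S.map C) L[X] := Polynomial.isLocalization S L
  let aL : Fin n → L[X] := fun i => (a i).map (algebraMap A L)
  obtain ⟨M, ⟨U, rfl⟩, i0, hi0⟩ := ha
  have hUi : ((U⁻¹ : (Matrix (Fin n) (Fin n) L[X])ˣ) : Matrix (Fin n) (Fin n) L[X]) *
    (U : Matrix (Fin n) (Fin n) L[X]) = 1 := Units.inv_mul _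
  have hiU : (U : Matrix (Fin n) (Fin n) L[X]) *
    ((U⁻¹ : (Matrix (Fin n) (Fin n) L[X])ˣ) : Matrix (Fin n) (Fin n) L[X]) = 1 := Units.mul_inv _
  set M := (U : Matrix (Fin n) (Fin n) L[X])
  set M' := ((U⁻¹ : (Matrix (Fin n) (Fin n) L[X])ˣ) : Matrix (Fin n) (Fin n) L[X])
  let cC : L[X] →+* L[X][X] := C
  let T : L[X] →+* L[X][X] := shiftHom 1
  let G := cC.mapMatrix M' * T.mapMatrix M
  let H := T.mapMatrix M' * cC.mapMatrix M
  have hGH : G * H = 1 := by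
    simp only [G, H]
    rw [mul_assoc, ← mul_assoc (T.mapMatrix M), ← map_mul, hiU, map_one, one_mul, ← map_mul, hUi,
      map_one]
  have haG : Matrix.vecMul (fun i => C (aL i)) G = fun i => T (aL i) := by
    have haL : ∀ j, M i0 j = aL j := fun j => congrFun hi0 j
    have h2 : (fun i => C (aL i)) = Matrix.vecMul (Pi.single i0 1) (cC.mapMatrix M) := by
      rw [Matrix.single_one_vecMul]; ext1 j; rw [← haL j]; rfl
    have h3 : (fun i => T (aL i)) = Matrix.vecMul (Pi.single i0 1) (T.mapMatrix M) := by
      rw [Matrix.single_one_vecMul]; ext1 j; rw [← haL j]; rfl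
    rw [h2, h3, Matrix.vecMul_vecMul]
    simp only [G]
    rw [← mul_assoc, ← map_mul, hiU, map_one, one_mul]
  let ev : L[X][X] →+* L[X] := Polynomial.evalRingHom 0
  have hevC : ev.comp cC = RingHom.id _ := RingHom.ext fun p => by simp [ev, cC]
  have hevT : ev.comp T = RingHom.id _ := by
    refine RingHom.ext fun p => ?_
    have := shiftHom_coeff_zero (1 : L) p
    rw [coeff_zero_eq_eval_zero] at this
    exact this
  have hmapid : ∀ (f : L[X] →+* L[X][X]), ev.comp f = RingHom.id _ → ∀ N : Matrix (Fin n) (Fin n) L[X],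
      ev.mapMatrix (f.mapMatrix N) = N := by
    intro f hf N
    ext1 i j
    exact congrArg (fun g => g (N i j)) hf
  have hG0 : ev.mapMatrix G = 1 := by
    simp only [G]; rw [map_mul, hmapid _ hevC, hmapid _ hevT, hUi]
  have hH0 : ev.mapMatrix H = 1 := by
    simp only [H]; rw [map_mul, hmapid _ hevC, hmapid _ hevT, hUi]
  obtain ⟨f', q, hq⟩ := scale_lift (S.map (C : A →+* A[X]))
    (Sum.elim (fun ij : Fin n × Fin n => G ij.1 ij.2) (fun ij : Fin n × Fin n => H ij.1 ij.2))
    (Sum.elim (fun ij : Fin n × Fin n => (1 : Matrix (Fin n) (Fin n) A[X]) ij.1 ij.2)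
      (fun ij : Fin n × Fin n => (1 : Matrix (Fin n) (Fin n) A[X]) ij.1 ij.2))
    (by
      rintro (⟨i, j⟩ | ⟨i, j⟩)
      · have := congrFun (congrFun hG0 i) j
        simp only [Sum.elim_inl]
        rw [coeff_zero_eq_eval_zero]
        refine Eq.trans this ?_
        rw [Matrix.one_apply, Matrix.one_apply]; split_ifs <;> simp
      · have := congrFun (congrFun hH0 i) j
        simp only [Sum.elim_inr]
        rw [coeff_zero_eq_eval_zero]
        refine Eq.trans this ?_
        rw [Matrix.one_apply, Matrix.one_apply]; split_ifs <;> simp)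
  obtain ⟨_, f, hf, rfl⟩ := f'
  let Γ : Matrix (Fin n) (Fin n) A[X][X] := Matrix.of fun i j => q (Sum.inl (i, j))
  let Δ : Matrix (Fin n) (Fin n) A[X][X] := Matrix.of fun i j => q (Sum.inr (i, j))
  let ρ : A[X][X] →+* L[X][X] := Polynomial.mapRingHom (algebraMap A[X] L[X])
  let θ : L[X][X] →+* L[X][X] := Polynomial.compRingHom (C (algebraMap A[X] L[X] (C f)) * X)
  have hΓ : ρ.mapMatrix Γ = θ.mapMatrix G := by
    ext1 i j; exact (hq (Sum.inl (i, j))).2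
  have hΔ : ρ.mapMatrix Δ = θ.mapMatrix H := by
    ext1 i j; exact (hq (Sum.inr (i, j))).2
  let ev' : A[X][X] →+* A[X] := Polynomial.evalRingHom 0
  have hΓ0 : ev'.mapMatrix Γ = 1 := by
    ext1 i j
    have := (hq (Sum.inl (i, j))).1
    rw [coeff_zero_eq_eval_zero] at this; exact this
  have hΔ0 : ev'.mapMatrix Δ = 1 := by
    ext1 i j
    have := (hq (Sum.inr (i, j))).1
    rw [coeff_zero_eq_eval_zero] at this; exact this
  have hρT : ρ.comp (shiftHom f) = (θ.comp T).comp (Polynomial.mapRingHom (algebraMap A L)) := by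
    refine Polynomial.ringHom_ext (fun u => ?_) ?_
    · simp [shiftHom_C, ρ, θ, T, halg]
    · simp [shiftHom_X, ρ, θ, T, halg]
  have hρC : ∀ p, ρ (C p) = θ (C (p.map (algebraMap A L))) := by
    intro p; simp [ρ, θ, halg]
  obtain ⟨g', hg'⟩ := scale_kill (K' := L[X]) (S.map (C : A →+* A[X]))
    (Sum.elim (fun ij : Fin n × Fin n => (Γ * Δ - 1) ij.1 ij.2)
      (fun j : Fin n => Matrix.vecMul (fun i => C (a i)) Γ j - shiftHom f (a j)))
    (by
      rintro (⟨i, j⟩ | j)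
      · have h1 : ev'.mapMatrix (Γ * Δ - 1) = 0 := by
          rw [map_sub, map_mul, hΓ0, hΔ0, map_one, mul_one, sub_self]
        have := congrFun (congrFun h1 i) j
        simp only [Sum.elim_inl]
        rw [coeff_zero_eq_eval_zero]; exact this
      · have h1 := congrFun (vecMul_map ev' (fun i => C (a i)) Γ) j
        rw [hΓ0, Matrix.vecMul_one] at h1
        simp only [Sum.elim_inr]
        rw [coeff_sub, shiftHom_coeff_zero, coeff_zero_eq_eval_zero]
        refine sub_eq_zero.2 (Eq.trans h1 ?_)
        simp [ev'])
    (by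
      rintro (⟨i, j⟩ | j)
      · have h1 : ρ.mapMatrix (Γ * Δ - 1) = 0 := by
          rw [map_sub, map_mul, hΓ, hΔ, ← map_mul, hGH, map_one, map_one, sub_self]
        exact congrFun (congrFun h1 i) j
      · have h1 := congrFun (vecMul_map ρ (fun i => C (a i)) Γ) j
        rw [hΓ] at h1
        simp only [hρC] at h1
        have h2 := congrFun (vecMul_map θ (fun i => C (aL i)) G) j
        rw [haG] at h2
        have h3 := congrArg (fun f => f (a j)) hρT
        simp only [Sum.elim_inr]
        rw [Polynomial.map_sub]
        refine sub_eq_zero.2 (Eq.trans h1 (Eq.trans h2.symm h3.symm)))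
  obtain ⟨_, g, hg, rfl⟩ := g'
  refine ⟨f * g, S.mul_mem hf hg, ?_⟩
  let η : A[X][X] →+* A[X][X] := Polynomial.compRingHom (C (C g) * X)
  have hηT : η.comp (shiftHom f) = shiftHom (f * g) := by
    refine Polynomial.ringHom_ext (fun u => ?_) ?_
    · simp [shiftHom_C, η]
    · simp [shiftHom_X, η]; ring
  refine ⟨η.mapMatrix Γ, ?_, ?_⟩
  · have h1 : η.mapMatrix (Γ * Δ - 1) = 0 := by
      ext1 i j; exact hg' (Sum.inl (i, j))
    rw [map_sub, map_mul, map_one, sub_eq_zero] at h1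
    exact IsUnit.of_mul_eq_one _ h1
  · ext1 j
    have h1 := congrFun (vecMul_map η (fun i => C (a i)) Γ) j
    have h2 : η (Matrix.vecMul (fun i => C (a i)) Γ j - shiftHom f (a j)) = 0 := hg' (Sum.inr j)
    rw [map_sub, h1, sub_eq_zero] at h2
    have h3 := congrArg (fun f => f (a j)) hηT
    have h4 : ∀ p, η (C p) = C p := fun p => by simp [η]
    simp only [h4] at h2
    exact h2.trans h3

theorem quillen_patch {A : Type} [CommRing A] {n : ℕ} (a : Fin n → A[X])
    (hloc : ∀ (P : Ideal A) [P.IsMaximal],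
      IsCompletable (fun i => (a i).map (algebraMap A (Localization.AtPrime P))))
    (h0 : IsCompletable (fun i => (a i).eval 0)) : IsCompletable a := by
  have htop : quillenIdeal a = ⊤ := by
    by_contra hne
    obtain ⟨P, hP, hle⟩ := Ideal.exists_le_maximal _ hne
    obtain ⟨f, hf, hfI⟩ := quillen_local P.primeCompl a (hloc P)
    exact hf (hle hfI)
  obtain ⟨G, hG, hGa⟩ : (1 : A) ∈ quillenIdeal a := by rw [htop]; trivial
  let μ : A[X][X] →+* A[X] := eval₂RingHom ((C : A →+* A[X]).comp (Polynomial.evalRingHom 0)) X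
  have h1 : ∀ p, μ (C p) = C (p.eval 0) := fun p => by simp [μ]
  have h2 : μ.comp (shiftHom 1) = RingHom.id _ := by
    refine Polynomial.ringHom_ext (fun u => ?_) ?_
    · simp [shiftHom_C, μ]
    · simp [shiftHom_X, μ]
  have h3 := vecMul_map μ (fun i => C (a i)) G
  rw [hGa] at h3
  simp only [h1] at h3
  have h4 : (fun j => μ (shiftHom 1 (a j))) = a := by
    ext1 j; exact congrArg (fun f => f (a j)) h2
  rw [h4] at h3
  rw [h3]
  exact isCompletable_vecMul _ (isCompletable_map C _ h0) _ (hG.map μ.mapMatrix)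

/-- **Theorem.** Suppose that for all `r ≥ 2` and all `k, n ∈ ℕ`, every unimodular row over
`B^ℤ_{r,k,n}[t]` which equals `(1, 0, …, 0)` at `t = 0` is completable.  Then for every
commutative local ring `R`, the ring `R[t]` is Hermite; consequently, for every commutative
Hermite ring `A`, the ring `A[t]` is Hermite. -/
theorem hermite_conjecture_of_testRings
    (h : ∀ r : ℕ, 2 ≤ r → ∀ k n : ℕ,
      ∀ a : Fin (r + 1) → Polynomial (BFin ℤ r k n), IsUnimodular a →
        (∀ i, (a i).eval 0 = if i = 0 then 1 else 0) → IsCompletable a) :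
    (∀ (R : Type) [CommRing R] [IsLocalRing R], IsHermite (Polynomial R)) ∧
    (∀ (A : Type) [CommRing A], IsHermite A → IsHermite (Polynomial A)) := by
  have hl := local_rows h
  refine ⟨fun R _ _ => isHermite_of_rows (hl R), fun A _ hA => isHermite_of_rows ?_⟩
  intro r a ha
  refine quillen_patch a ?_ ?_
  · intro P hP
    have hm := isUnimodular_map (Polynomial.mapRingHom (algebraMap A (Localization.AtPrime P))) a ha
    exact hl (Localization.AtPrime P) r _ hm
  · have hm := isUnimodular_map (Polynomial.evalRingHom 0) a ha
    exact rows_of_isHermite hA r _ hm
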